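/- arXiv:0808.3544 — 2 statements merged into one kernel-verified Lean document; each statement's English description precedes it below -/
import Mathlib

section
/- Let p be an odd prime and let s ≥ 1 and i ≥ 0 be integers; set m = s(p−1) and n = (m+i)p − i. If u is a partition that is reduced with respect to p, with w(u) = n and d(u) ≤ i+1, then v_p(τ_u) ≥ s(p−2) − 1. -/
open Finsupp MvPolynomial

noncomputable section

/-- weight of a partition (given as the multiplicity function of its parts) -/
def wt (u : ℕ →₀ ℕ) : ℕ := u.sum fun i m => i * m

/-- degree (number of parts) -/
def deg (u : ℕ →₀ ℕ) : ℕ := u.sum fun _ m => m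

/-- γ_u = Π_i (i+1)^{u_i} (u_i)! -/
def gam (u : ℕ →₀ ℕ) : ℕ := u.prod fun i m => (i + 1) ^ m * m.factorial

/-- τ_u = (−1)^{d(u)−1} (w(u)+d(u)−2)! / γ_u -/
def tau (u : ℕ →₀ ℕ) : ℚ :=
  (-1 : ℚ) ^ (deg u - 1) * (Nat.factorial (wt u + deg u - 2) : ℚ) / (gam u : ℚ)

/-- p-adic valuation on ℚ with v_p(0) = ⊤ -/
def pval (p : ℕ) (x : ℚ) : WithTop ℤ :=
  if x = 0 then ⊤ else ((padicValRat p x : ℤ) : WithTop ℤ)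

/-- u is reduced with respect to p: there is at most one part g not of the form
p^α − 1 (α ≥ 1), that part has multiplicity 1, and all other parts with nonzero
multiplicity are of the form p^α − 1. -/
def ReducedPart (p : ℕ) (u : ℕ →₀ ℕ) : Prop :=
  ∀ g, u g ≠ 0 → (¬ ∃ α ≥ 1, g = p ^ α - 1) →
    u g = 1 ∧ ∀ g', u g' ≠ 0 → (¬ ∃ α ≥ 1, g' = p ^ α - 1) → g' = g

/-- The arithmetic of a part `p ^ (k + 1) - 1`, written as `(p - 1) * (p * z + 1)` with
`z = (p ^ k - 1) / (p - 1)`. -/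
theorem exists_pow_succ_eq_and_padicValNat_factorial (p : ℕ) [hp : Fact p.Prime] (k : ℕ) :
    ∃ z, p ^ (k + 1) = (p - 1) * (p * z + 1) + 1 ∧ k ≤ z ∧
      ∀ a, padicValNat p (a * p ^ (k + 1)).factorial
        = padicValNat p a.factorial + a * (p * z + 1) := by
  obtain ⟨q, rfl⟩ : ∃ q, p = q + 1 := ⟨p - 1, by have := hp.out.two_le; omega⟩
  induction k with
  | zero =>
    refine ⟨0, by simp, le_rfl, fun a => ?_⟩
    rw [zero_add, pow_one, mul_comm, padicValNat_factorial_mul]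
    ring
  | succ k ih =>
    obtain ⟨z, h1, h2, h3⟩ := ih
    refine ⟨(q + 1) * z + 1, ?_, by nlinarith, fun a => ?_⟩
    · rw [pow_succ, h1]
      simp only [add_tsub_cancel_right]
      ring
    · rw [pow_succ, show a * ((q + 1) ^ (k + 1) * (q + 1)) = (q + 1) * (a * (q + 1) ^ (k + 1)) by
        ring, padicValNat_factorial_mul, h3, h1]
      simp only [add_tsub_cancel_right]
      ring

theorem padicValNat_pow_pow_mul_factorial (p : ℕ) [hp : Fact p.Prime] (k a : ℕ) :
    padicValNat p ((p ^ k) ^ a * a.factorial) = a * k + padicValNat p a.factorial := by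
  rw [← pow_mul, padicValNat.mul (pow_ne_zero _ hp.out.ne_zero) (Nat.factorial_ne_zero _),
    padicValNat.prime_pow, mul_comm]

/-- The valuation estimate for the parts of the form `p ^ α - 1`. -/
theorem exists_eq_mul_and_padicValNat_le (p : ℕ) [hp : Fact p.Prime] {x : ℕ}
    (hx : ∃ α ≥ 1, x = p ^ α - 1) :
    ∃ z, x = (p - 1) * (p * z + 1) ∧ p ∣ x + 1 ∧
      (∀ a, padicValNat p ((x + 1) ^ a * a.factorial) + (p - 2) * (a * z)
        ≤ padicValNat p (a * (x + 1)).factorial) ∧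
      (0 < z → ∀ a, 0 < a → padicValNat p ((x + 1) ^ a * a.factorial) + (p - 2) * (a * z)
        ≤ padicValNat p (a * (x + 1) - 1).factorial + 1) := by
  obtain ⟨α, hα, rfl⟩ := hx
  obtain ⟨k, rfl⟩ := Nat.exists_eq_add_of_le' hα
  obtain ⟨z, h1, h2, h3⟩ := exists_pow_succ_eq_and_padicValNat_factorial p k
  have hx1 : p ^ (k + 1) - 1 + 1 = p ^ (k + 1) := by omega
  obtain ⟨q, hq⟩ : ∃ q, p = q + 2 := ⟨p - 2, by have := hp.out.two_le; omega⟩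
  have hq' : p - 2 = q := by omega
  refine ⟨z, by omega, ?_, fun a => ?_, fun hz a ha => ?_⟩
  · rw [hx1]; exact dvd_pow_self p (by omega)
  · rw [hx1, h3, padicValNat_pow_pow_mul_factorial, hq', hq]
    have : a * k ≤ a * z := Nat.mul_le_mul_left _ h2
    nlinarith
  · have hpos : 0 < a * p ^ (k + 1) := Nat.mul_pos ha (pow_pos hp.out.pos _)
    have hfac : padicValNat p (a * p ^ (k + 1)).factorial = padicValNat p a + (k + 1)
        + padicValNat p (a * p ^ (k + 1) - 1).factorial := by
      rw [← Nat.mul_factorial_pred hpos.ne', padicValNat.mul hpos.ne' (Nat.factorial_ne_zero _),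
        padicValNat.mul ha.ne' (pow_ne_zero _ hp.out.ne_zero), padicValNat.prime_pow]
    rw [h3] at hfac
    rw [hx1, padicValNat_pow_pow_mul_factorial, hq']
    rw [hq] at hfac ⊢
    have hv : padicValNat (q + 2) a < a :=
      (padicValNat_le_nat_log a).trans_lt (Nat.log_lt_self _ ha.ne')
    obtain ⟨a, rfl⟩ := Nat.exists_eq_add_of_le' ha
    have hk : (a + 1) * k ≤ (a + 1) * z := Nat.mul_le_mul_left _ h2
    have hz' : a ≤ a * z := Nat.le_mul_of_pos_right _ hz
    nlinarith

theorem div_le_padicValNat_factorial (p : ℕ) [hp : Fact p.Prime] (n : ℕ) :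
    n / p ≤ padicValNat p n.factorial := by
  rw [← padicValNat_mul_div_factorial, padicValNat_factorial_mul]
  omega

/-- The valuation estimate for a part not of the form `p ^ α - 1`. -/
theorem padicValNat_succ_le_of_ne_pow (p : ℕ) [hp : Fact p.Prime] {c h : ℕ} (hc : 0 < c)
    (hch : c = (p - 1) * h) (hne : ¬ ∃ α ≥ 1, c = p ^ α - 1) :
    padicValNat p (c + 1) + (p - 2) * (h / p) ≤ padicValNat p (c - 1).factorial + 1 := by
  have hF := div_le_padicValNat_factorial p (c - 1)
  obtain ⟨q, hq⟩ : ∃ q, p = q + 2 := ⟨p - 2, by have := hp.out.two_le; omega⟩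
  have hq1 : p - 1 = q + 1 := by omega
  have hq2 : p - 2 = q := by omega
  rw [hq1] at hch
  rw [hq2]
  have hW : p * (h / p) ≤ h := Nat.mul_div_le h p
  have hcW : (q + 1) * (h / p) * p ≤ c := by
    rw [hch, mul_assoc, mul_comm (h / p)]; exact Nat.mul_le_mul_left _ hW
  by_cases ht : padicValNat p (c + 1) = 0
  · have : (q + 1) * (h / p) ≤ (c - 1) / p + 1 := by
      rw [← Nat.add_div_right _ hp.out.pos, Nat.le_div_iff_mul_le hp.out.pos]
      have := hp.out.two_le
      omega
    rw [ht]
    nlinarith [Nat.zero_le (h / p)]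
  · have hpc : p ∣ c + 1 := dvd_of_one_le_padicValNat (by omega)
    have hlt : (q + 1) * (h / p) * p ≠ c := by
      intro he
      have h2 : p ∣ c := he ▸ Dvd.intro_left _ rfl
      exact hp.out.one_lt.ne' (Nat.dvd_one.1 ((Nat.dvd_add_right h2).1 hpc))
    have hFW : (q + 1) * (h / p) ≤ (c - 1) / p := by
      rw [Nat.le_div_iff_mul_le hp.out.pos]; omega
    suffices padicValNat p (c + 1) ≤ h / p + 1 by nlinarith
    rcases Nat.lt_or_ge (padicValNat p (c + 1)) 2 with h2 | h2
    · exact (Nat.lt_succ_iff.1 h2).trans (Nat.le_add_left _ _)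
    obtain ⟨t, hteq⟩ := Nat.exists_eq_add_of_le' h2
    obtain ⟨e, he⟩ : p ^ (t + 2) ∣ c + 1 := hteq ▸ pow_padicValNat_dvd
    rw [hteq]
    have he2 : 2 ≤ e := by
      by_contra! hlt
      interval_cases e
      · omega
      · exact hne ⟨t + 2, by omega, by omega⟩
    have hpt : t < p ^ t := Nat.lt_pow_self hp.out.one_lt
    suffices t + 1 ≤ h / p by omega
    rw [Nat.le_div_iff_mul_le hp.out.pos]
    by_contra! hlt
    have h3 : c + 1 ≤ (q + 1) * ((t + 1) * p) := by
      rw [hch]; nlinarith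
    have h4 : (q + 1) * ((t + 1) * p) ≤ p ^ 2 * (t + 1) := by
      rw [hq]; nlinarith [Nat.zero_le (t * (q + 2)), Nat.zero_le q]
    have h5 : p ^ 2 * (t + 1) ≤ p ^ 2 * p ^ t := Nat.mul_le_mul_left _ hpt
    have h6 : p ^ (t + 2) * 2 ≤ p ^ (t + 2) * e := Nat.mul_le_mul_left _ he2
    have h7 : p ^ (t + 2) = p ^ 2 * p ^ t := by ring
    have h8 : 0 < p ^ (t + 2) := pow_pos hp.out.pos _
    omega

theorem gam_ne_zero (u : ℕ →₀ ℕ) : gam u ≠ 0 :=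
  Finset.prod_ne_zero_iff.2 fun _ _ =>
    mul_ne_zero (pow_ne_zero _ (Nat.succ_ne_zero _)) (Nat.factorial_ne_zero _)

theorem padicValNat_prod {ι : Type*} (p : ℕ) [hp : Fact p.Prime] (T : Finset ι) (f : ι → ℕ)
    (hf : ∀ x ∈ T, f x ≠ 0) : padicValNat p (∏ x ∈ T, f x) = ∑ x ∈ T, padicValNat p (f x) := by
  classical
  induction T using Finset.induction_on with
  | empty => simp
  | insert a T ha ih =>
    have hT : ∀ x ∈ T, f x ≠ 0 := fun x hx => hf x (Finset.mem_insert_of_mem hx)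
    rw [Finset.prod_insert ha, Finset.sum_insert ha,
      padicValNat.mul (hf a (Finset.mem_insert_self _ _)) (Finset.prod_ne_zero_iff.2 hT), ih hT]

theorem padicValNat_le_of_dvd (p : ℕ) [hp : Fact p.Prime] {a b : ℕ} (hb : b ≠ 0) (h : a ∣ b) :
    padicValNat p a ≤ padicValNat p b := by
  obtain ⟨c, rfl⟩ := h
  rw [padicValNat.mul (left_ne_zero_of_mul hb) (right_ne_zero_of_mul hb)]
  omega

/-- Combining the estimates for the individual parts, with one distinguished part `c`. -/
theorem padicValNat_gam_add_le (p : ℕ) [hp : Fact p.Prime] {s i : ℕ} {u : ℕ →₀ ℕ} {z : ℕ → ℕ}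
    {c H K W R : ℕ} (hc : c ∈ u.support)
    (hz : ∀ x ∈ u.support.erase c, x = (p - 1) * (p * z x + 1) ∧
      ∀ a, padicValNat p ((x + 1) ^ a * a.factorial) + (p - 2) * (a * z x)
        ≤ padicValNat p (a * (x + 1)).factorial)
    (hw : wt u = (p - 1) * (s * p + i)) (hd : deg u ≤ i + 1)
    (hH : c * u c = (p - 1) * H) (hHW : H + 1 < p * W + p + u c)
    (hK : padicValNat p ((c + 1) ^ u c * (u c).factorial) + (p - 2) * W
      ≤ padicValNat p K.factorial + 1)
    (hR : R + c * u c + u c = wt u + deg u + K) :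
    padicValNat p (gam u) + (p - 2) * s ≤ padicValNat p R.factorial + 1 := by
  set T := u.support.erase c with hT
  have hwt : wt u = c * u c + ∑ x ∈ T, x * u x := (Finset.add_sum_erase _ _ hc).symm
  have hdeg : deg u = u c + ∑ x ∈ T, u x := (Finset.add_sum_erase _ _ hc).symm
  have hgam : padicValNat p (gam u) = padicValNat p ((c + 1) ^ u c * (u c).factorial)
      + ∑ x ∈ T, padicValNat p ((x + 1) ^ u x * (u x).factorial) := by
    have h0 : ∀ x ∈ u.support, (x + 1) ^ u x * (u x).factorial ≠ 0 := fun _ _ =>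
      mul_ne_zero (pow_ne_zero _ (Nat.succ_ne_zero _)) (Nat.factorial_ne_zero _)
    exact (padicValNat_prod p _ _ h0).trans (Finset.add_sum_erase _ _ hc).symm
  have hTw : ∑ x ∈ T, x * u x = (p - 1) * (p * (∑ x ∈ T, u x * z x) + ∑ x ∈ T, u x) := by
    rw [Finset.mul_sum, ← Finset.sum_add_distrib, Finset.mul_sum]
    refine Finset.sum_congr rfl fun x hx => ?_
    calc x * u x = (p - 1) * (p * z x + 1) * u x := congrArg (· * u x) (hz x hx).1
      _ = _ := by ring
  have hTv : ∑ x ∈ T, padicValNat p ((x + 1) ^ u x * (u x).factorial)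
      + (p - 2) * ∑ x ∈ T, u x * z x ≤ ∑ x ∈ T, padicValNat p (u x * (x + 1)).factorial := by
    rw [Finset.mul_sum, ← Finset.sum_add_distrib]
    exact Finset.sum_le_sum fun x hx => (hz x hx).2 _
  have hRK : R = K + ∑ x ∈ T, u x * (x + 1) := by
    have : ∑ x ∈ T, u x * (x + 1) = ∑ x ∈ T, x * u x + ∑ x ∈ T, u x := by
      rw [← Finset.sum_add_distrib]
      exact Finset.sum_congr rfl fun x _ => by ring
    omega
  have hRv : padicValNat p K.factorial + ∑ x ∈ T, padicValNat p (u x * (x + 1)).factorial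
      ≤ padicValNat p R.factorial := by
    rw [← padicValNat_prod p T _ fun x _ => Nat.factorial_ne_zero _, ← padicValNat.mul
      (Nat.factorial_ne_zero _) (Finset.prod_ne_zero_iff.2 fun x _ => Nat.factorial_ne_zero _), hRK]
    exact padicValNat_le_of_dvd p (Nat.factorial_ne_zero _)
      ((Nat.mul_dvd_mul_left _ (Nat.prod_factorial_dvd_factorial_sum _ _)).trans
        (Nat.factorial_mul_factorial_dvd_factorial_add _ _))
  have hs : s ≤ W + ∑ x ∈ T, u x * z x := by
    have hp1 : 0 < p - 1 := by have := hp.out.two_le; omega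
    have h1 : s * p + i = H + (p * (∑ x ∈ T, u x * z x) + ∑ x ∈ T, u x) := by
      apply Nat.eq_of_mul_eq_mul_left hp1
      rw [← hw, hwt, hH, hTw, mul_add (p - 1) H]
    have h2 : p * s < p * (W + ∑ x ∈ T, u x * z x + 1) := by
      rw [mul_add, mul_add, mul_one, mul_comm p s]
      omega
    exact Nat.lt_succ_iff.1 (Nat.lt_of_mul_lt_mul_left h2)
  have hs' := Nat.mul_le_mul_left (p - 2) hs
  rw [mul_add] at hs'
  omega

theorem padicValNat_gam_add_le_factorial (p : ℕ) [hp : Fact p.Prime] (hodd : p ≠ 2) {s i : ℕ}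
    (hs : 1 ≤ s) {u : ℕ →₀ ℕ} (hu0 : u 0 = 0) (hred : ReducedPart p u)
    (hw : wt u = (p - 1) * (s * p + i)) (hd : deg u ≤ i + 1) :
    padicValNat p (gam u) + (p - 2) * s
      ≤ padicValNat p (wt u + deg u - 2).factorial + 1 := by
  have hp3 : 3 ≤ p := by have := hp.out.two_le; omega
  have hex : ∀ x, ∃ z, (∃ α ≥ 1, x = p ^ α - 1) → x = (p - 1) * (p * z + 1) ∧ p ∣ x + 1 ∧
      (∀ a, padicValNat p ((x + 1) ^ a * a.factorial) + (p - 2) * (a * z)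
        ≤ padicValNat p (a * (x + 1)).factorial) ∧
      (0 < z → ∀ a, 0 < a → padicValNat p ((x + 1) ^ a * a.factorial) + (p - 2) * (a * z)
        ≤ padicValNat p (a * (x + 1) - 1).factorial + 1) := by
    intro x
    by_cases hx : ∃ α ≥ 1, x = p ^ α - 1
    · obtain ⟨z, h⟩ := exists_eq_mul_and_padicValNat_le p hx
      exact ⟨z, fun _ => h⟩
    · exact ⟨0, fun h => (hx h).elim⟩
  choose z hz using hex
  by_cases hbad : ∃ c, u c ≠ 0 ∧ ¬ ∃ α ≥ 1, c = p ^ α - 1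
  · obtain ⟨c, huc, hcb⟩ := hbad
    obtain ⟨hc1, huniq⟩ := hred c huc hcb
    have hc : c ∈ u.support := Finsupp.mem_support_iff.2 huc
    have hc0 : 0 < c := Nat.pos_of_ne_zero fun h => huc (h ▸ hu0)
    have hgood : ∀ x ∈ u.support.erase c, ∃ α ≥ 1, x = p ^ α - 1 := by
      intro x hx
      by_contra hxb
      exact Finset.ne_of_mem_erase hx
        (huniq x (Finsupp.mem_support_iff.1 (Finset.mem_of_mem_erase hx)) hxb)
    have hwt : wt u = c * u c + ∑ x ∈ u.support.erase c, x * u x :=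
      (Finset.add_sum_erase _ _ hc).symm
    obtain ⟨h, hh⟩ : p - 1 ∣ c := by
      have h1 : p - 1 ∣ ∑ x ∈ u.support.erase c, x * u x := Finset.dvd_sum fun x hx =>
        Dvd.dvd.mul_right ⟨_, (hz x (hgood x hx)).1⟩ _
      have h2 : p - 1 ∣ wt u := ⟨_, hw⟩
      rw [hwt, hc1, mul_one] at h2
      exact (Nat.dvd_add_left h1).1 h2
    have hdeg : deg u = u c + ∑ x ∈ u.support.erase c, u x := (Finset.add_sum_erase _ _ hc).symm
    have hlt : h < p * (h / p) + p := by
      have := Nat.lt_mul_div_succ h hp.out.pos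
      rwa [mul_add, mul_one] at this
    refine padicValNat_gam_add_le p (H := h) (K := c - 1) (W := h / p) hc
      (fun x hx => ⟨(hz x (hgood x hx)).1, (hz x (hgood x hx)).2.2.1⟩) hw hd ?_ ?_ ?_ ?_
    · rw [hc1, mul_one, hh]
    · omega
    · rw [hc1]
      simpa using padicValNat_succ_le_of_ne_pow p hc0 hh hcb
    · rw [hc1] at hwt hdeg ⊢
      omega
  · push Not at hbad
    have hgood : ∀ x ∈ u.support, ∃ α ≥ 1, x = p ^ α - 1 := fun x hx =>
      hbad x (Finsupp.mem_support_iff.1 hx)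
    obtain ⟨c, hc, hzc⟩ : ∃ c ∈ u.support, 0 < z c := by
      by_contra! hcon
      have h1 : wt u = (p - 1) * deg u := by
        rw [wt, deg, Finsupp.sum, Finsupp.sum, Finset.mul_sum]
        refine Finset.sum_congr rfl fun x hx => ?_
        have h2 := (hz x (hgood x hx)).1
        rw [Nat.le_zero.1 (hcon x hx), mul_zero, zero_add, mul_one] at h2
        rw [h2]
      rw [hw] at h1
      have h2 := Nat.eq_of_mul_eq_mul_left (by omega) h1
      nlinarith
    have huc : 0 < u c := Nat.pos_of_ne_zero (Finsupp.mem_support_iff.1 hc)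
    have hpM : p ∣ wt u + deg u := by
      rw [wt, deg, Finsupp.sum, Finsupp.sum, ← Finset.sum_add_distrib]
      refine Finset.dvd_sum fun x hx => ?_
      rw [← Nat.succ_mul]
      exact (hz x (hgood x hx)).2.1.mul_right _
    have hM : 0 < wt u + deg u := by
      have : u c ≤ deg u :=
        Finset.single_le_sum (f := fun x => u x) (fun _ _ => Nat.zero_le _) hc
      omega
    have hM2 : p ≤ wt u + deg u := Nat.le_of_dvd hM hpM
    have hfac : padicValNat p (wt u + deg u - 2).factorial
        = padicValNat p (wt u + deg u - 1).factorial := by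
      have hnd : ¬ p ∣ wt u + deg u - 1 := fun h => by
        have h3 := (Nat.dvd_sub hpM h)
        rw [show wt u + deg u - (wt u + deg u - 1) = 1 by omega] at h3
        exact hp.out.one_lt.ne' (Nat.dvd_one.1 h3)
      rw [← Nat.mul_factorial_pred (show wt u + deg u - 1 ≠ 0 by omega),
        padicValNat.mul (by omega) (Nat.factorial_ne_zero _),
        padicValNat.eq_zero_of_not_dvd hnd, zero_add, Nat.sub_sub]
    rw [hfac]
    have hpos : 0 < u c * (c + 1) := Nat.mul_pos huc (Nat.succ_pos _)
    refine padicValNat_gam_add_le p (z := z) (H := u c * (p * z c + 1)) (K := u c * (c + 1) - 1)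
      (W := u c * z c) hc (fun x hx => ?_) hw hd ?_ ?_ ?_ ?_
    · have h := hz x (hgood x (Finset.mem_of_mem_erase hx))
      exact ⟨h.1, h.2.2.1⟩
    · calc c * u c = (p - 1) * (p * z c + 1) * u c :=
            congrArg (· * u c) (hz c (hgood c hc)).1
        _ = _ := by ring
    · nlinarith
    · exact (hz c (hgood c hc)).2.2.2 hzc _ huc
    · have : u c * (c + 1) = c * u c + u c := by ring
      omega

/-- for an odd prime p, m = s(p−1), n = (m+i)p − i, and any reduced
partition u of n with d(u) ≤ i+1, one has v_p(τ_u) ≥ s(p−2) − 1. -/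
theorem stmt_1 (p : ℕ) (hp : p.Prime) (hodd : p ≠ 2) (s i : ℕ) (hs : 1 ≤ s)
    (m n : ℕ) (hm : m = s * (p - 1)) (hn : n = (m + i) * p - i)
    (u : ℕ →₀ ℕ) (hu0 : u 0 = 0) (hred : ReducedPart p u)
    (hw : wt u = n) (hd : deg u ≤ i + 1) :
    (((s : ℤ) * ((p : ℤ) - 2) - 1 : ℤ) : WithTop ℤ) ≤ pval p (tau u) := by
  have : Fact p.Prime := ⟨hp⟩
  have hp2 := hp.two_le
  have hw' : wt u = (p - 1) * (s * p + i) := by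
    obtain ⟨q, rfl⟩ : ∃ q, p = q + 1 := ⟨p - 1, by omega⟩
    rw [hw, hn, hm]
    simp only [add_tsub_cancel_right]
    apply Nat.sub_eq_of_eq_add
    ring
  have key := padicValNat_gam_add_le_factorial p hodd hs hu0 hred hw' hd
  have hg : (gam u : ℚ) ≠ 0 := Nat.cast_ne_zero.2 (gam_ne_zero u)
  have hf : (Nat.factorial (wt u + deg u - 2) : ℚ) ≠ 0 :=
    Nat.cast_ne_zero.2 (Nat.factorial_ne_zero _)
  have hsgn : (-1 : ℚ) ^ (deg u - 1) ≠ 0 := pow_ne_zero _ (by norm_num)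
  have hsv : padicValRat p ((-1 : ℚ) ^ (deg u - 1)) = 0 := by
    rcases neg_one_pow_eq_or ℚ (deg u - 1) with h | h <;> simp [h]
  have hne : tau u ≠ 0 := div_ne_zero (mul_ne_zero hsgn hf) hg
  rw [pval, if_neg hne, WithTop.coe_le_coe, tau, padicValRat.div (mul_ne_zero hsgn hf) hg,
    padicValRat.mul hsgn hf, hsv]
  zify [hp2] at key
  linarith

end
end

section
/- For an integer a ≥ 2 define g(a) = (−1)^{a−1}·(2a−3)!!/(2a) ∈ ℚ. Let N ≥ 3 be an integer, k an odd positive integer, l = k·2^N, m ≥ 2 an integer, and n = l + m. Then: if m is odd, v_2( g(n) − g(m) − (−1)^{(m−1)/2}·l/2 ) ≥ N + 1; if m ≡ 2 (mod 4), v_2( g(n) − g(m) − l − l/(2mn) ) ≥ N + 1; if m ≡ 4 (mod 8), v_2( g(n) − g(m) − l + l/(2mn) ) ≥ N + 1. -/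
noncomputable section

/-- double factorial of an odd number: a!! = a(a−2)⋯3·1 -/
def dfac : ℕ → ℕ
  | 0 => 1
  | 1 => 1
  | n + 2 => (n + 2) * dfac n

/-- g(a) = (−1)^{a−1}·(2a−3)!!/(2a) -/
def g (a : ℕ) : ℚ := (-1 : ℚ) ^ (a - 1) * (dfac (2 * a - 3) : ℚ) / (2 * a)

/-- The signed double factorial `(-1)^(a-1) (2a-3)!!`, the numerator of `g a`. -/
def signedDfac (a : ℕ) : ℤ := (-1) ^ (a - 1) * (dfac (2 * a - 3) : ℤ)

/-- The product of the `l` consecutive odd numbers `1 - 2m, 1 - 2(m+1), …`. -/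
def oddProd (m : ℤ) (l : ℕ) : ℤ := ∏ i ∈ Finset.range l, (1 - 2 * (m + i))

lemma g_eq (a : ℕ) : g a = (signedDfac a : ℚ) / (2 * a) := by
  simp [g, signedDfac]

lemma signedDfac_succ (a : ℕ) (ha : 1 ≤ a) :
    signedDfac (a + 1) = signedDfac a * (1 - 2 * (a : ℤ)) := by
  obtain rfl | ⟨b, rfl⟩ : a = 1 ∨ ∃ b, a = b + 2 := by
    rcases Nat.lt_or_ge a 2 with h | h
    · left; omega
    · right; exact ⟨a - 2, by omega⟩
  · simp [signedDfac, dfac]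
  · have h1 : 2 * (b + 2 + 1) - 3 = (2 * b + 1) + 2 := by omega
    have h2 : 2 * (b + 2) - 3 = 2 * b + 1 := by omega
    simp only [signedDfac, h1, h2, dfac, Nat.add_sub_cancel, show b + 2 - 1 = b + 1 by omega]
    push_cast
    ring

lemma signedDfac_add (m l : ℕ) (hm : 1 ≤ m) :
    signedDfac (m + l) = signedDfac m * oddProd m l := by
  induction l with
  | zero => simp [oddProd]
  | succ l ih =>
    rw [← add_assoc, signedDfac_succ _ (by omega), ih, oddProd, oddProd,
      Finset.prod_range_succ]
    push_cast
    ring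

lemma oddProd_add (m : ℤ) (a b : ℕ) :
    oddProd m (a + b) = oddProd m a * oddProd (m + a) b := by
  simp only [oddProd, Finset.prod_range_add]
  congr 1
  refine Finset.prod_congr rfl fun i _ => ?_
  push_cast
  ring

lemma oddProd_two_pow_succ (m : ℤ) (N : ℕ) :
    oddProd m (2 ^ (N + 1)) = oddProd m (2 ^ N) * oddProd (m + 2 ^ N) (2 ^ N) := by
  rw [pow_succ, mul_two, oddProd_add]
  norm_num

lemma oddProd_eight (m : ℤ) :
    oddProd m 8 = 256 * (m + 3) ^ 8 - 5376 * (m + 3) ^ 6 + 31584 * (m + 3) ^ 4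
      - 51664 * (m + 3) ^ 2 + 11025 := by
  simp only [oddProd, Finset.prod_range_succ, Finset.prod_range_zero]
  push_cast
  ring

/-- Shifting the start of a block of length `2 ^ N` by an even `d` changes the product
by a multiple of `32 d`. -/
lemma dvd_oddProd_shift (N : ℕ) (hN : 3 ≤ N) (m e : ℤ) :
    64 * e ∣ oddProd (m + 2 * e) (2 ^ N) - oddProd m (2 ^ N) := by
  induction N, hN using Nat.le_induction generalizing m with
  | base =>
    norm_num only [oddProd_eight]
    obtain ⟨t, rfl⟩ : ∃ t, m = t - 3 := ⟨m + 3, by ring⟩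
    have h (i : ℕ) : 2 * e ∣ (t + 2 * e) ^ i - t ^ i := by
      simpa using sub_dvd_pow_sub_pow (t + 2 * e) t i
    obtain ⟨a, ha⟩ := h 8
    obtain ⟨b, hb⟩ := h 6
    obtain ⟨c, hc⟩ := h 4
    refine ⟨8 * a - 168 * b + 987 * c - 3229 * (t + e), ?_⟩
    rw [show t - 3 + 2 * e + 3 = t + 2 * e by ring, show t - 3 + 3 = t by ring]
    linear_combination 256 * ha - 5376 * hb + 31584 * hc
  | succ N hN ih =>
    rw [oddProd_two_pow_succ, oddProd_two_pow_succ]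
    obtain ⟨a, ha⟩ := ih m
    obtain ⟨b, hb⟩ := ih (m + 2 ^ N)
    rw [show m + 2 ^ N + 2 * e = m + 2 * e + 2 ^ N by ring] at hb
    refine ⟨a * oddProd (m + 2 * e + 2 ^ N) (2 ^ N) + oddProd m (2 ^ N) * b, ?_⟩
    linear_combination oddProd (m + 2 * e + 2 ^ N) (2 ^ N) * ha + oddProd m (2 ^ N) * hb

lemma dvd_oddProd_shift_self (N : ℕ) (hN : 3 ≤ N) (m : ℤ) :
    32 * 2 ^ N ∣ oddProd (m + 2 ^ N) (2 ^ N) - oddProd m (2 ^ N) := by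
  obtain ⟨M, rfl⟩ : ∃ M, N = M + 1 := ⟨N - 1, by omega⟩
  have h := dvd_oddProd_shift (M + 1) hN m (2 ^ M)
  rwa [show (2 : ℤ) * 2 ^ M = 2 ^ (M + 1) by ring,
    show (64 : ℤ) * 2 ^ M = 32 * 2 ^ (M + 1) by ring] at h

lemma oddProd_two_pow_of_even (N : ℕ) (hN : 3 ≤ N) (m : ℤ) (hm : Even m) :
    ∃ a, oddProd m (2 ^ N) = 1 + 4 * 2 ^ N + 16 * 2 ^ N * a := by
  induction N, hN using Nat.le_induction with
  | base =>
    obtain ⟨r, rfl⟩ := hm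
    obtain ⟨u, hu⟩ : ∃ u : ℤ, (r + r + 3) ^ 2 = 1 + 8 * u := by
      obtain ⟨v, hv⟩ := Int.even_mul_succ_self (r + 1)
      exact ⟨v, by linear_combination 4 * hv⟩
    norm_num only [oddProd_eight]
    refine ⟨2 * (1 + 8 * u) ^ 4 - 42 * (1 + 8 * u) ^ 3 + 987 * (u + 4 * u ^ 2) * 4
      - 3229 * u - 71, ?_⟩
    rw [show (r + r + 3) ^ 8 = ((r + r + 3) ^ 2) ^ 4 by ring,
      show (r + r + 3) ^ 6 = ((r + r + 3) ^ 2) ^ 3 by ring,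
      show (r + r + 3) ^ 4 = ((r + r + 3) ^ 2) ^ 2 by ring, hu]
    ring
  | succ N hN ih =>
    obtain ⟨a, ha⟩ := ih
    obtain ⟨b, hb⟩ := dvd_oddProd_shift_self N hN m
    obtain ⟨M, rfl⟩ : ∃ M, N = M + 1 := ⟨N - 1, by omega⟩
    rw [oddProd_two_pow_succ, eq_add_of_sub_eq hb, ha]
    refine ⟨a + b + 2 ^ M + 16 * 2 ^ M * a * a + 8 * 2 ^ M * a
      + b * (4 * 2 ^ (M + 1) + 16 * 2 ^ (M + 1) * a), ?_⟩
    ring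

lemma oddProd_two_pow_of_odd (N : ℕ) (hN : 3 ≤ N) (m : ℤ) (hm : Odd m) :
    ∃ a, oddProd m (2 ^ N) = 1 + 2 * 2 ^ N + 4 * 2 ^ N * a := by
  induction N, hN using Nat.le_induction with
  | base =>
    obtain ⟨r, rfl⟩ := hm
    norm_num only [oddProd_eight]
    refine ⟨8 * (2 * r + 4) ^ 8 - 168 * (2 * r + 4) ^ 6 + 987 * (2 * r + 4) ^ 4
      - 3229 * 2 * (r + 2) ^ 2 + 344, ?_⟩
    ring
  | succ N hN ih =>
    obtain ⟨a, ha⟩ := ih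
    obtain ⟨b, hb⟩ := dvd_oddProd_shift_self N hN m
    obtain ⟨M, rfl⟩ : ∃ M, N = M + 1 := ⟨N - 1, by omega⟩
    rw [oddProd_two_pow_succ, eq_add_of_sub_eq hb, ha]
    refine ⟨a + 2 ^ M * (1 + 2 * a) ^ 2
      + 4 * b * (1 + 2 * 2 ^ (M + 1) + 4 * 2 ^ (M + 1) * a), ?_⟩
    ring

lemma oddProd_mul_of_even (N k : ℕ) (hN : 3 ≤ N) (m : ℤ) (hm : Even m) :
    ∃ a, oddProd m (k * 2 ^ N) = 1 + 4 * (k * 2 ^ N) + 16 * 2 ^ N * a := by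
  induction k with
  | zero => exact ⟨0, by simp [oddProd]⟩
  | succ k ih =>
    obtain ⟨a, ha⟩ := ih
    have he : Even (m + ((k * 2 ^ N : ℕ) : ℤ)) := by
      push_cast
      exact hm.add ((even_two.pow_of_ne_zero (by omega)).mul_left _)
    obtain ⟨b, hb⟩ := oddProd_two_pow_of_even N hN _ he
    rw [Nat.succ_mul, oddProd_add, ha, hb]
    refine ⟨k * 2 ^ N + b * (1 + 4 * (k * 2 ^ N) + 16 * 2 ^ N * a)
      + a * (1 + 4 * 2 ^ N), ?_⟩
    push_cast
    ring

lemma oddProd_mul_of_odd (N k : ℕ) (hN : 3 ≤ N) (m : ℤ) (hm : Odd m) :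
    ∃ a, oddProd m (k * 2 ^ N) = 1 + 2 * (k * 2 ^ N) + 4 * 2 ^ N * a := by
  induction k with
  | zero => exact ⟨0, by simp [oddProd]⟩
  | succ k ih =>
    obtain ⟨a, ha⟩ := ih
    have ho : Odd (m + ((k * 2 ^ N : ℕ) : ℤ)) := by
      push_cast
      exact hm.add_even ((even_two.pow_of_ne_zero (by omega)).mul_left _)
    obtain ⟨b, hb⟩ := oddProd_two_pow_of_odd N hN _ ho
    rw [Nat.succ_mul, oddProd_add, ha, hb]
    refine ⟨k * 2 ^ N + b * (1 + 2 * (k * 2 ^ N) + 4 * 2 ^ N * a)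
      + a * (1 + 2 * 2 ^ N), ?_⟩
    push_cast
    ring

lemma signedDfac_two_mul_add_one (j : ℕ) :
    ∃ b, signedDfac (2 * j + 1) = (-1) ^ j + 4 * b := by
  induction j with
  | zero => exact ⟨0, by simp [signedDfac, dfac]⟩
  | succ j ih =>
    obtain ⟨b, hb⟩ := ih
    rw [show 2 * (j + 1) + 1 = 2 * j + 1 + 2 by ring, signedDfac_add _ _ (by omega), hb]
    simp only [oddProd, Finset.prod_range_succ, Finset.prod_range_zero]
    refine ⟨(-1) ^ j * (1 + 4 * j + 4 * j ^ 2)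
      + b * (3 + 16 * j + 16 * j ^ 2), ?_⟩
    push_cast
    ring

lemma signedDfac_four_mul_add_two (j : ℕ) :
    ∃ b, signedDfac (4 * j + 2) = -1 + 16 * b := by
  induction j with
  | zero => exact ⟨0, by simp [signedDfac, dfac]⟩
  | succ j ih =>
    obtain ⟨b, hb⟩ := ih
    rw [show 4 * (j + 1) + 2 = 4 * j + 2 + 4 by ring, signedDfac_add _ _ (by omega), hb]
    simp only [oddProd, Finset.prod_range_succ, Finset.prod_range_zero]
    refine ⟨b * ((3 + 8 * j) * (5 + 8 * j) * (7 + 8 * j) * (9 + 8 * j))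
      - (59 + 372 * j + 824 * j ^ 2 + 768 * j ^ 3 + 256 * j ^ 4), ?_⟩
    push_cast
    ring

lemma signedDfac_eight_mul_add_four (j : ℕ) :
    ∃ b, signedDfac (8 * j + 4) = -15 + 32 * j + 64 * b := by
  induction j with
  | zero => exact ⟨0, by simp [signedDfac, dfac]⟩
  | succ j ih =>
    obtain ⟨b, hb⟩ := ih
    obtain ⟨c, hc⟩ := oddProd_two_pow_of_even 3 le_rfl ((8 * j + 4 : ℕ) : ℤ)
      (by push_cast; exact ⟨4 * j + 2, by ring⟩)
    norm_num only at hc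
    rw [show 8 * (j + 1) + 4 = 8 * j + 4 + 8 by ring, signedDfac_add _ _ (by omega), hb]
    refine ⟨-8 + 16 * j + 33 * b + 2 * c * (-15 + 32 * j + 64 * b), ?_⟩
    push_cast at hc ⊢
    rw [hc]
    ring

/-- A rational number with odd multiplier landing in `2 ^ N ℤ` has valuation at least `N`. -/
lemma le_pval_two_of_mul_eq (N : ℕ) (q : ℚ) (D Y : ℤ) (hD : Odd D)
    (h : q * D = 2 ^ N * Y) : ((N : ℤ) : WithTop ℤ) ≤ pval 2 q := by
  unfold pval
  split_ifs with hq
  · exact le_top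
  have hD0 : D ≠ 0 := by rintro rfl; simp at hD
  have hDq : (D : ℚ) ≠ 0 := by exact_mod_cast hD0
  have hY : (Y : ℚ) ≠ 0 := by
    rintro hY
    rw [hY, mul_zero] at h
    exact mul_ne_zero hq hDq h
  have hv := congrArg (padicValRat 2) h
  rw [padicValRat.mul hq hDq, padicValRat.mul (by positivity) hY, padicValRat.of_int,
    padicValRat.of_int, padicValInt.eq_zero_of_not_dvd
      (by simpa [← even_iff_two_dvd] using hD), padicValRat.pow] at hv
  have h2 : padicValRat 2 (2 : ℚ) = 1 := by
    simpa using padicValRat.self (p := 2) (by norm_num)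
  rw [h2] at hv
  push_cast at hv
  exact WithTop.coe_le_coe.2 (by omega)

/-- for N ≥ 3, k odd, l = k·2^N, m ≥ 2, n = l + m:
g(n) − g(m) ≡ (−1)^{(m−1)/2}·l/2 (mod 2^{N+1}) if m is odd,
g(n) − g(m) ≡ l + l/(2mn) (mod 2^{N+1}) if m ≡ 2 (mod 4),
g(n) − g(m) ≡ l − l/(2mn) (mod 2^{N+1}) if m ≡ 4 (mod 8). -/
theorem stmt_12 (N k : ℕ) (hN : 3 ≤ N) (hk : 1 ≤ k) (hkodd : Odd k)
    (l m n : ℕ) (hl : l = k * 2 ^ N) (hm : 2 ≤ m) (hn : n = l + m) :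
    (Odd m →
      (((N : ℤ) + 1 : ℤ) : WithTop ℤ) ≤
        pval 2 (g n - g m - (-1 : ℚ) ^ ((m - 1) / 2) * (l : ℚ) / 2))
    ∧ (m % 4 = 2 →
      (((N : ℤ) + 1 : ℤ) : WithTop ℤ) ≤
        pval 2 (g n - g m - (l : ℚ) - (l : ℚ) / (2 * (m : ℚ) * (n : ℚ))))
    ∧ (m % 8 = 4 →
      (((N : ℤ) + 1 : ℤ) : WithTop ℤ) ≤
        pval 2 (g n - g m - (l : ℚ) + (l : ℚ) / (2 * (m : ℚ) * (n : ℚ)))) := by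
  have hm0 : (m : ℚ) ≠ 0 := by positivity
  have hn0 : (n : ℚ) ≠ 0 := by
    have : n ≠ 0 := by omega
    exact_mod_cast this
  have hG : signedDfac n = signedDfac m * oddProd m l := by
    rw [hn, add_comm, signedDfac_add _ _ (by omega)]
  obtain ⟨M, rfl⟩ : ∃ M, N = M + 3 := ⟨N - 3, by omega⟩
  have hlM : l = 8 * (k * 2 ^ M) := by rw [hl]; ring
  have hlq : (l : ℚ) = k * 2 ^ (M + 3) := by rw [hl]; push_cast; ring
  have hnq : (n : ℚ) = 8 * (k * 2 ^ M) + m := by rw [hn, hlM]; push_cast; ring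
  have hdiff : (g n - g m) * (2 * m * n)
      = signedDfac m * (m * oddProd m l - n) := by
    rw [g_eq, g_eq, hG]
    push_cast
    field_simp
  refine ⟨fun hmo => ?_, fun hm4 => ?_, fun hm8 => ?_⟩
  · obtain ⟨j, rfl⟩ := hmo
    obtain ⟨a, ha⟩ := oddProd_mul_of_odd (M + 3) k hN ((2 * j + 1 : ℕ) : ℤ)
      (by push_cast; exact ⟨j, rfl⟩)
    obtain ⟨b, hb⟩ := signedDfac_two_mul_add_one j
    rw [show (2 * j + 1 - 1) / 2 = j by omega]
    rw [← hl] at ha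
    rw [ha, hb] at hdiff
    refine le_pval_two_of_mul_eq (M + 3 + 1) _ (((2 * j + 1 : ℕ) : ℤ) * n)
      ((-1) ^ j * ((2 * j + 1) * a - k * (j ^ 2 + 2 * (2 * j + 1) * k * 2 ^ M))
        + b * ((2 * j + 1) * (2 * k + 4 * a) - k)) ?_ ?_
    · refine Odd.mul (by push_cast; exact ⟨j, rfl⟩) ?_
      rw [hn, hlM]
      push_cast
      exact ⟨4 * (k * 2 ^ M) + j, by ring⟩
    · push_cast at hdiff ⊢ hnq
      rw [hnq] at hdiff ⊢
      rw [hlq]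
      linear_combination (1 / 2) * hdiff
  · obtain ⟨j, rfl⟩ : ∃ j, m = 4 * j + 2 := ⟨m / 4, by omega⟩
    obtain ⟨a, ha⟩ := oddProd_mul_of_even (M + 3) k hN ((4 * j + 2 : ℕ) : ℤ)
      (by push_cast; exact ⟨2 * j + 1, by ring⟩)
    obtain ⟨b, hb⟩ := signedDfac_four_mul_add_two j
    rw [← hl] at ha
    rw [ha, hb] at hdiff
    refine le_pval_two_of_mul_eq (M + 3 + 1) _ ((2 * j + 1) * (4 * (k * 2 ^ M) + 2 * j + 1))
      (-(4 * j + 2) * a - (2 * j + 1) * k * (2 * (k * 2 ^ M) + j + 1)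
        + b * ((4 * j + 2) * (4 * k + 16 * a) - k)) ?_ ?_
    · exact Odd.mul ⟨j, rfl⟩ ⟨2 * (k * 2 ^ M) + j, by ring⟩
    · push_cast at hdiff hnq hm0 ⊢
      have hc : (l : ℚ) / (2 * (4 * j + 2) * n) * (2 * (4 * j + 2) * n) = l := by
        field_simp
      rw [hnq, hlq] at hc ⊢
      rw [hnq] at hdiff
      linear_combination (1 / 8) * hdiff - (1 / 8) * hc
  · obtain ⟨j, rfl⟩ : ∃ j, m = 8 * j + 4 := ⟨m / 8, by omega⟩
    obtain ⟨a, ha⟩ := oddProd_mul_of_even (M + 3) k hN ((8 * j + 4 : ℕ) : ℤ)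
      (by push_cast; exact ⟨4 * j + 2, by ring⟩)
    obtain ⟨b, hb⟩ := signedDfac_eight_mul_add_four j
    rw [← hl] at ha
    rw [ha, hb] at hdiff
    refine le_pval_two_of_mul_eq (M + 3 + 1) _
      ((2 * j + 1) * (2 * (k * 2 ^ M) + 2 * j + 1))
      ((-15 + 32 * j) * (2 * j + 1) * a + k * (16 * j ^ 2 - 4)
        - k * (2 * j ^ 2 + 2 * j + (2 * j + 1) * (k * 2 ^ M))
        + b * ((8 * j + 4) * (4 * k + 16 * a) - k)) ?_ ?_
    · exact Odd.mul ⟨j, rfl⟩ ⟨k * 2 ^ M + j, by ring⟩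
    · push_cast at hdiff hnq hm0 ⊢
      have hc : (l : ℚ) / (2 * (8 * j + 4) * n) * (2 * (8 * j + 4) * n) = l := by
        field_simp
      rw [hnq, hlq] at hc ⊢
      rw [hnq] at hdiff
      linear_combination (1 / 32) * hdiff + (1 / 32) * hc

end
end
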